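/- arXiv:2102.01377 — 3 statements merged into one kernel-verified Lean document; each statement's English description precedes it below -/
import Mathlib

section
/- Let V be a vector space over a field F, let K : V → V be a linear map, and let P : V → V be a linear idempotent (projection), with complementary map Q = id − P. Then for every natural number n ≥ 0 the operator identity P ∘ K ∘ (Q ∘ K)^n = P ∘ K^{n+1} − Σ_{i=1}^{n} P ∘ K ∘ (Q ∘ K)^{i−1} ∘ P ∘ K^{n−i+1} holds as an equality of linear maps on V. -/
/-- Discrete Duhamel expansion of the powers of `(1 - p) * k` around those of `k`. -/
theorem one_sub_mul_pow_eq_sub_sum {R : Type*} [Ring R] (k p : R) (n : ℕ) :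
    ((1 - p) * k) ^ n =
      k ^ n - ∑ j ∈ Finset.range n, ((1 - p) * k) ^ j * (p * k ^ (n - j)) := by
  induction n with
  | zero => simp
  | succ n ih =>
    have hsum : ∑ j ∈ Finset.range n, ((1 - p) * k) ^ j * (p * k ^ (n + 1 - j)) =
        (∑ j ∈ Finset.range n, ((1 - p) * k) ^ j * (p * k ^ (n - j))) * k := by
      rw [Finset.sum_mul]
      refine Finset.sum_congr rfl fun j hj => ?_
      rw [Nat.succ_sub (Finset.mem_range.mp hj).le, pow_succ]
      simp only [mul_assoc]
    calc ((1 - p) * k) ^ (n + 1)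
        = ((1 - p) * k) ^ n * k - ((1 - p) * k) ^ n * (p * k) := by
          rw [pow_succ, ← mul_sub, sub_mul, one_mul]
      _ = k ^ (n + 1) -
            ∑ j ∈ Finset.range (n + 1), ((1 - p) * k) ^ j * (p * k ^ (n + 1 - j)) := by
          rw [Finset.sum_range_succ, hsum, Nat.add_sub_cancel_left, pow_one, ← sub_sub,
            pow_succ k n, ← sub_mul, ← ih]

/-- **Operator identity behind the Mori–Zwanzig recurrence.**
For a linear map `K` on a vector space `V` over a field `F`, a linear projection `P`
(`P ∘ P = P`) with complementary map `Q = id − P`, and any `n : ℕ`,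
`P ∘ K ∘ (Q ∘ K)^n = P ∘ K^(n+1) − ∑_{i=1}^{n} P ∘ K ∘ (Q ∘ K)^(i−1) ∘ P ∘ K^(n−i+1)`. -/
theorem stmt_0 {F V : Type*} [Field F] [AddCommGroup V] [Module F V]
    (K P : V →ₗ[F] V) (hP : P ∘ₗ P = P) (Q : V →ₗ[F] V) (hQ : Q = LinearMap.id - P)
    (n : ℕ) :
    P ∘ₗ K ∘ₗ ((Q ∘ₗ K) ^ n) =
      P ∘ₗ (K ^ (n + 1)) -
        ∑ i ∈ Finset.Icc 1 n,
          P ∘ₗ K ∘ₗ ((Q ∘ₗ K) ^ (i - 1)) ∘ₗ P ∘ₗ (K ^ (n - i + 1)) := by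
  simp only [← Module.End.mul_eq_comp, ← Module.End.one_eq_id] at hQ ⊢
  rw [hQ, one_sub_mul_pow_eq_sub_sum K P n, mul_sub, mul_sub, ← pow_succ', Finset.mul_sum,
    Finset.mul_sum, ← Finset.Ico_add_one_right_eq_Icc, Finset.sum_Ico_eq_sum_range,
    Nat.add_sub_cancel]
  congr 1
  refine Finset.sum_congr rfl fun j hj => ?_
  have hjn := Finset.mem_range.mp hj
  rw [Nat.add_sub_cancel_left, show n - (1 + j) + 1 = n - j by lia]
end

section
/- Let H be a real inner product space, let u ∈ H with ⟨u, u⟩ ≠ 0, let K : H → H be a linear map, let P be the Mori projection P h = (⟨h, u⟩ / ⟨u, u⟩) · u, and let Q = id − P. Define for integers i ≥ 1 the scalars μ_i = ⟨K (Q K)^{i−1} u, u⟩ / ⟨u, u⟩ and γ_i = ⟨K^i u, u⟩ / ⟨u, u⟩. Then for every n ≥ 1 one has the recurrence μ_n = γ_n − Σ_{j=1}^{n−1} μ_{n−j} γ_j (in particular μ_1 = γ_1 and μ_2 = γ_2 − μ_1 γ_1). -/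
open RealInnerProductSpace

/-- Iterates of a rank-one perturbation `T = K - φ(·) u` expanded in powers of `K` at `u`. -/
theorem pow_rankOne_perturbation_apply {R M : Type*} [Ring R] [AddCommGroup M] [Module R M]
    {K T : Module.End R M} {φ : M → R} {u : M} (hT : ∀ x, T x = K x - φ x • u) (m : ℕ) :
    (T ^ m) u = (K ^ m) u -
      ∑ j ∈ Finset.range m, φ ((T ^ (m - (j + 1))) u) • (K ^ j) u := by
  induction m with
  | zero => simp
  | succ m ih =>
    have h : (T ^ (m + 1)) u = K ((T ^ m) u) - φ ((T ^ m) u) • u := by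
      rw [pow_succ', Module.End.mul_apply, hT]
    have h' : K ((T ^ m) u) = (K ^ (m + 1)) u -
        ∑ j ∈ Finset.range m, φ ((T ^ (m - (j + 1))) u) • (K ^ (j + 1)) u := by
      conv_lhs => rw [ih]
      simp only [map_sub, map_sum, map_smul, pow_succ', Module.End.mul_apply]
    rw [h, h', Finset.sum_range_succ']
    simp only [Nat.add_sub_add_right, zero_add, pow_zero, Module.End.one_apply]
    abel

/-- **Recurrence for the Mori–Zwanzig moments.**
For the one-dimensional Mori projection `P h = (⟪h,u⟫/⟪u,u⟫) • u` with `⟪u,u⟫ ≠ 0`,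
`Q = id − P`, and scalars `μ_i = ⟪K (QK)^(i−1) u, u⟫/⟪u,u⟫`, `γ_i = ⟪K^i u, u⟫/⟪u,u⟫`,
one has `μ_n = γ_n − ∑_{j=1}^{n−1} μ_{n−j} γ_j` for every `n ≥ 1`. -/
theorem stmt_1 {H : Type*} [NormedAddCommGroup H] [InnerProductSpace ℝ H]
    (u : H) (hu : ⟪u, u⟫ ≠ 0)
    (K P Q : H →ₗ[ℝ] H)
    (hP : ∀ h, P h = (⟪h, u⟫ / ⟪u, u⟫) • u)
    (hQ : Q = LinearMap.id - P)
    (μ γ : ℕ → ℝ)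
    (hμ : ∀ i, 1 ≤ i → μ i = ⟪(K ∘ₗ ((Q ∘ₗ K) ^ (i - 1))) u, u⟫ / ⟪u, u⟫)
    (hγ : ∀ i, 1 ≤ i → γ i = ⟪(K ^ i) u, u⟫ / ⟪u, u⟫)
    (n : ℕ) (hn : 1 ≤ n) :
    μ n = γ n - ∑ j ∈ Finset.Icc 1 (n - 1), μ (n - j) * γ j := by
  obtain ⟨m, rfl⟩ := Nat.exists_eq_add_of_le' hn
  have hT : ∀ x, (Q ∘ₗ K) x = K x - (⟪K x, u⟫ / ⟪u, u⟫) • u := fun x => by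
    simp [hQ, hP]
  rw [hμ _ hn, hγ _ hn, Nat.add_sub_cancel, LinearMap.comp_apply,
    pow_rankOne_perturbation_apply (φ := fun x => ⟪K x, u⟫ / ⟪u, u⟫) hT m, map_sub, map_sum,
    inner_sub_left, sum_inner, sub_div, Finset.sum_div, pow_succ', Module.End.mul_apply]
  congr 1
  refine Finset.sum_bij (fun j _ => j + 1) (fun j hj => ?_) (fun _ _ _ _ h => by simpa using h)
    (fun j hj => ?_) (fun j hj => ?_)
  · simp only [Finset.mem_range, Finset.mem_Icc] at hj ⊢
    omega
  · simp only [Finset.mem_range, Finset.mem_Icc] at hj ⊢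
    exact ⟨j - 1, by omega, by omega⟩
  · rw [Finset.mem_range] at hj
    rw [hμ _ (by omega), hγ _ (by omega), map_smul, real_inner_smul_left, mul_div_assoc,
      pow_succ', Module.End.mul_apply, Nat.add_sub_add_right, Nat.sub_sub, LinearMap.comp_apply]
end

section
/- Let H be a real inner product space, let u_1, …, u_M ∈ H be linearly independent, let P : H → H be a linear projection (P ∘ P = P) whose range is span{u_1, …, u_M}, let Q = id − P, and let K : H → H be a linear map. Suppose (M_n)_{n≥1} and (Γ_n)_{n≥1} are sequences of real M×M matrices satisfying, for every n ≥ 1 and every j ∈ {1,…,M}, P K (Q K)^{n−1} u_j = Σ_{k=1}^M (M_n)_{jk} u_k and P K^n u_j = Σ_{k=1}^M (Γ_n)_{jk} u_k. Then for every n ≥ 1 the matrix recurrence M_n = Γ_n − Σ_{i=1}^{n−1} Γ_{n−i} M_i holds. -/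
open RealInnerProductSpace

/-- Discrete Duhamel expansion of the powers of `a + b`. -/
theorem add_pow_eq_pow_add_sum_duhamel {R : Type*} [Semiring R] (a b : R) (m : ℕ) :
    (a + b) ^ m =
      a ^ m + ∑ i ∈ Finset.range m, a ^ i * (b * (a + b) ^ (m - 1 - i)) := by
  induction m with
  | zero => simp
  | succ m ih =>
    rw [Finset.sum_range_succ', pow_succ', add_mul]
    nth_rewrite 1 [ih]
    rw [mul_add, Finset.mul_sum, ← pow_succ', add_assoc]
    congr 2
    · refine Finset.sum_congr rfl fun i _ => ?_
      rw [← mul_assoc a, ← pow_succ', show m + 1 - 1 - (i + 1) = m - 1 - i by lia]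
    · simp

/-- **Matrix form of the Mori–Zwanzig recurrence.**
For a linear projection `P` onto the span of linearly independent `u_1,…,u_M`,
`Q = id − P`, a linear map `K`, and matrices `M_n`, `Γ_n` determined by
`P K (QK)^(n−1) u_j = ∑_k (M_n)_{jk} u_k` and `P K^n u_j = ∑_k (Γ_n)_{jk} u_k`,
one has `M_n = Γ_n − ∑_{i=1}^{n−1} Γ_{n−i} M_i` for every `n ≥ 1`. -/
theorem stmt_2 {H : Type*} [NormedAddCommGroup H] [InnerProductSpace ℝ H]
    {M : ℕ} (u : Fin M → H) (hu : LinearIndependent ℝ u)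
    (P Q K : H →ₗ[ℝ] H) (hP : P ∘ₗ P = P)
    (hrange : LinearMap.range P = Submodule.span ℝ (Set.range u))
    (hQ : Q = LinearMap.id - P)
    (Mn Γn : ℕ → Matrix (Fin M) (Fin M) ℝ)
    (hM : ∀ n, 1 ≤ n → ∀ j, P (K (((Q ∘ₗ K) ^ (n - 1)) (u j))) = ∑ k, Mn n j k • u k)
    (hΓ : ∀ n, 1 ≤ n → ∀ j, P ((K ^ n) (u j)) = ∑ k, Γn n j k • u k)
    (n : ℕ) (hn : 1 ≤ n) :
    Mn n = Γn n - ∑ i ∈ Finset.Icc 1 (n - 1), Γn (n - i) * Mn i := by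
  obtain ⟨m, rfl⟩ : ∃ m, n = m + 1 := ⟨n - 1, by lia⟩
  have hK : Q * K + P * K = K := by rw [hQ]; ext x; simp
  have key (j : Fin M) : ∑ k, Γn (m + 1) j k • u k = ∑ k, Mn (m + 1) j k • u k +
      ∑ i ∈ Finset.range m, ∑ k, (Γn (m - i) * Mn (i + 1)) j k • u k := by
    rw [← hΓ _ hn, ← hM _ hn, pow_succ', Module.End.mul_apply]
    have h := add_pow_eq_pow_add_sum_duhamel (Q * K) (P * K) m
    rw [hK] at h
    nth_rewrite 1 [h]
    rw [LinearMap.add_apply, map_add, map_add, LinearMap.sum_apply, map_sum, map_sum]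
    congr 1
    refine Finset.sum_congr rfl fun i hi => ?_
    have hi : i < m := Finset.mem_range.mp hi
    have hstep : (P * K * K ^ (m - 1 - i)) (u j) = ∑ k, Γn (m - i) j k • u k := by
      rw [← hΓ _ (by lia), mul_assoc, ← pow_succ', show m - 1 - i + 1 = m - i by lia]
      rfl
    have hMi (k : Fin M) : P (K (((Q * K) ^ i) (u k))) = ∑ l, Mn (i + 1) k l • u l :=
      hM (i + 1) (by lia) k
    rw [Module.End.mul_apply, hstep]
    simp only [map_sum, map_smul, hMi, Matrix.mul_apply, Finset.sum_smul, Finset.smul_sum,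
      smul_smul]
    exact Finset.sum_comm
  rw [eq_sub_iff_add_eq]
  have hsum : ∑ i ∈ Finset.Icc 1 (m + 1 - 1), Γn (m + 1 - i) * Mn i =
      ∑ i ∈ Finset.range m, Γn (m - i) * Mn (i + 1) := by
    rw [← Finset.Ico_succ_right_eq_Icc, Finset.sum_Ico_eq_sum_range]
    refine Finset.sum_congr (by simp) fun i _ => ?_
    rw [show m + 1 - (1 + i) = m - i by lia, add_comm 1 i]
  rw [hsum]
  ext j k
  refine congrFun (hu.fintypeLinearCombination_injective (a₁ := fun k => (Mn (m + 1) +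
    ∑ i ∈ Finset.range m, Γn (m - i) * Mn (i + 1)) j k) (a₂ := Γn (m + 1) j) ?_) k
  simp only [Fintype.linearCombination_apply, key, Matrix.add_apply, Matrix.sum_apply,
    add_smul, Finset.sum_smul, Finset.sum_add_distrib]
  rw [Finset.sum_comm]
end
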